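/- For every subset D of U^{|z|} and small parameter set A, the following are equivalent: (1) e(D/A) has finite VC-dimension; (2) o(C/A) has finite VC-dimension for some (equivalently, every) saturated C with ⟨U,C⟩ ≡_A ⟨U,D⟩. -/

import Mathlib

namespace Paper

open FirstOrder Language Cardinal Set

universe u

variable (L : FirstOrder.Language.{u, u}) (U : Type u) [iS : L.Structure U]

/-- A language consisting of a single `n`-ary relation symbol. -/
def predLang (n : ℕ) : FirstOrder.Language.{u, u} where
  Functions := fun _ => PEmpty
  Relations := fun m => ULift (PLift (m = n))

/-- The language `L` together with one new `n`-ary relation symbol. -/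
def expLang (n : ℕ) : FirstOrder.Language.{u, u} := L.sum (predLang n)

/-- The expansion `⟨U, D⟩` of `U` by a predicate for `D ⊆ U^n`. -/
def expStr {n : ℕ} (D : Set (Fin n → U)) : (expLang L n).Structure U where
  funMap := fun {_} f x =>
    match f with
    | Sum.inl f => Structure.funMap f x
    | Sum.inr f => f.elim
  RelMap := fun {_} r x =>
    match r with
    | Sum.inl r => Structure.RelMap r x
    | Sum.inr h => (x ∘ Fin.cast h.down.down.symm) ∈ D

/-- Add the elements of `A : Set U` as constants to an arbitrary structure on `U`. -/
def addConsts {L' : FirstOrder.Language.{u, u}} (S : L'.Structure U) (A : Set U) :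
    (L'[[↥A]]).Structure U :=
  letI := S
  letI : (constantsOn ↥A).Structure U := constantsOn.structure Subtype.val
  Language.sumStructure _ _ _

/-- Add all elements of `U` as constants to an arbitrary structure on `U`. -/
def addAllConsts {L' : FirstOrder.Language.{u, u}} (S : L'.Structure U) :
    (L'[[U]]).Structure U :=
  letI := S
  letI : (constantsOn U).Structure U := constantsOn.structure id
  Language.sumStructure _ _ _

/-- Realization of a formula with respect to an explicitly given structure. -/
def FRealize {L' : FirstOrder.Language.{u, u}} (S : L'.Structure U) {α : Type*}
    (φ : L'.Formula α) (v : α → U) : Prop :=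
  @Formula.Realize L' U S α φ v

/-- Realization of a sentence with respect to an explicitly given structure. -/
def SentRealize {L' : FirstOrder.Language.{u, u}} (S : L'.Structure U) (φ : L'.Sentence) : Prop :=
  @Sentence.Realize L' U S φ

/-- A structure on `U` is saturated if every type over a parameter set of cardinality `< #U`
which is finitely realized is realized. -/
def IsSatStr {L' : FirstOrder.Language.{u, u}} (S : L'.Structure U) : Prop :=
  ∀ A : Set U, #A < #U → ∀ (m : ℕ) (p : Set ((L'[[↥A]]).Formula (Fin m))),
    (∀ s : Finset ((L'[[↥A]]).Formula (Fin m)), ↑s ⊆ p →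
      ∃ b : Fin m → U, ∀ φ ∈ s, FRealize U (addConsts U S A) φ b) →
    ∃ b : Fin m → U, ∀ φ ∈ p, FRealize U (addConsts U S A) φ b

/-- `D ⊆ U^n` is saturated if the expansion `⟨U, D⟩` is a saturated structure. -/
def SatSet {n : ℕ} (D : Set (Fin n → U)) : Prop :=
  IsSatStr U (expStr L U D)

/-- `⟨U,C⟩ ≡_A ⟨U,D⟩` : the two expansions satisfy the same sentences with parameters in `A`. -/
def EqvOver {n : ℕ} (A : Set U) (C D : Set (Fin n → U)) : Prop :=
  ∀ φ : ((expLang L n)[[↥A]]).Sentence,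
    SentRealize U (addConsts U (expStr L U C) A) φ ↔
      SentRealize U (addConsts U (expStr L U D) A) φ

/-- `e(D/A)`, the class of all `C` with `⟨U,C⟩ ≡_A ⟨U,D⟩`. -/
def eSet {n : ℕ} (A : Set U) (D : Set (Fin n → U)) : Set (Set (Fin n → U)) :=
  {C | EqvOver L U A C D}

/-- The group `Aut(U/A)` of automorphisms of `U` fixing `A` pointwise (as a set). -/
def AutFix (A : Set U) : Set (U ≃[L] U) :=
  {f | ∀ a ∈ A, f a = a}

/-- The image of a set of tuples under an automorphism. -/
def imgSet {n : ℕ} (f : U ≃[L] U) (D : Set (Fin n → U)) : Set (Fin n → U) :=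
  (fun b => ⇑f ∘ b) '' D

/-- The orbit `o(D/A)` of `D` under `Aut(U/A)`. -/
def oSet {n : ℕ} (A : Set U) (D : Set (Fin n → U)) : Set (Set (Fin n → U)) :=
  {C | ∃ f ∈ AutFix L U A, imgSet L U f D = C}

/-- The orbit `o(b/A)` of a tuple `b` under `Aut(U/A)`. -/
def oTuple {n : ℕ} (A : Set U) (b : Fin n → U) : Set (Fin n → U) :=
  {c | ∃ f ∈ AutFix L U A, ⇑f ∘ b = c}

/-- A family of sets shatters `B` if every subset of `B` is the trace of a member. -/
def Shatters {α : Type*} (u : Set (Set α)) (B : Set α) : Prop :=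
  ∀ H ⊆ B, ∃ D ∈ u, D ∩ B = H

/-- A family of sets has finite VC dimension if for some `N` it shatters no `N`-element set. -/
def FiniteVC {α : Type*} (u : Set (Set α)) : Prop :=
  ∃ N : ℕ, ∀ B : Finset α, B.card = N → ¬Shatters u ↑B

/-- `B^{|z|}`, the set of tuples with coordinates in `B`. -/
def tuplesIn {n : ℕ} (B : Set U) : Set (Fin n → U) :=
  {a | ∀ i, a i ∈ B}

/-- `φ(b, U)`, the set defined by `φ(x,z)` with `x ↦ b`. -/
def phiSet {m n : ℕ} (φ : L.Formula (Fin m ⊕ Fin n)) (b : Fin m → U) :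
    Set (Fin n → U) :=
  {a | φ.Realize (Sum.elim b a)}

/-- `D` is approximable by `φ(x,z)` : every finite trace of `D` is the trace of
some instance `φ(b,U)`. -/
def ApproxBy {n : ℕ} (D : Set (Fin n → U)) {m : ℕ} (φ : L.Formula (Fin m ⊕ Fin n)) : Prop :=
  ∀ B : Finset U, ∃ b : Fin m → U,
    phiSet L U φ b ∩ tuplesIn U ↑B = D ∩ tuplesIn U ↑B

/-- `D` is approximable from below by `φ(x,z)`. -/
def ApproxBelowBy {n : ℕ} (D : Set (Fin n → U)) {m : ℕ}
    (φ : L.Formula (Fin m ⊕ Fin n)) : Prop :=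
  ∀ B : Finset U, ∃ b : Fin m → U,
    phiSet L U φ b ∩ tuplesIn U ↑B = D ∩ tuplesIn U ↑B ∧ phiSet L U φ b ⊆ D

/-- `D` is approximable from above by `φ(x,z)`. -/
def ApproxAboveBy {n : ℕ} (D : Set (Fin n → U)) {m : ℕ}
    (φ : L.Formula (Fin m ⊕ Fin n)) : Prop :=
  ∀ B : Finset U, ∃ b : Fin m → U,
    phiSet L U φ b ∩ tuplesIn U ↑B = D ∩ tuplesIn U ↑B ∧ D ⊆ phiSet L U φ b

def Approximable {n : ℕ} (D : Set (Fin n → U)) : Prop :=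
  ∃ (m : ℕ) (φ : L.Formula (Fin m ⊕ Fin n)), ApproxBy L U D φ

def ApproxBelow {n : ℕ} (D : Set (Fin n → U)) : Prop :=
  ∃ (m : ℕ) (φ : L.Formula (Fin m ⊕ Fin n)), ApproxBelowBy L U D φ

def ApproxAbove {n : ℕ} (D : Set (Fin n → U)) : Prop :=
  ∃ (m : ℕ) (φ : L.Formula (Fin m ⊕ Fin n)), ApproxAboveBy L U D φ

/-- The formula `φ(x, a)` (an `L(U)`-formula in the variables `x`), obtained by
substituting the tuple `a` for the variables `z` in `φ(x,z)`. -/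
def instFormula {m n : ℕ} (φ : L.Formula (Fin m ⊕ Fin n)) (a : Fin n → U) :
    (L[[U]]).Formula (Fin m) :=
  ((L.lhomWithConstants U).onFormula φ).subst
    (Sum.elim (fun i => Term.var i) (fun j => (L.con (a j)).term))

/-- A (complete) global type in the variables `x = (x_0, ..., x_{m-1})` : a maximal
finitely realized set of `L(U)`-formulas. -/
def IsGlobalType {m : ℕ} (p : Set ((L[[U]]).Formula (Fin m))) : Prop :=
  (∀ s : Finset ((L[[U]]).Formula (Fin m)), ↑s ⊆ p →
    ∃ b : Fin m → U, ∀ φ ∈ s, FRealize U (addAllConsts U iS) φ b) ∧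
  ∀ φ : (L[[U]]).Formula (Fin m), φ ∈ p ↔ φ.not ∉ p

/-- `D` is externally definable: `D = {a : φ(x,a) ∈ p}` for some global type `p` and
formula `φ(x,z)`. -/
def ExtDefinable {n : ℕ} (D : Set (Fin n → U)) : Prop :=
  ∃ (m : ℕ) (φ : L.Formula (Fin m ⊕ Fin n)) (p : Set ((L[[U]]).Formula (Fin m))),
    IsGlobalType L U p ∧ D = {a | instFormula L U φ a ∈ p}

/-- A sequence of `n`-tuples is indiscernible with respect to the formulas of a
structure `S` on `U`. -/
def IndiscIn {L' : FirstOrder.Language.{u, u}} (S : L'.Structure U) {n : ℕ} {I : Type*} [LinearOrder I]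
    (a : I → Fin n → U) : Prop :=
  ∀ (k : ℕ) (i j : Fin k → I), StrictMono i → StrictMono j →
    ∀ φ : L'.Formula (Fin k × Fin n),
      FRealize U S φ (fun q => a (i q.1) q.2) ↔ FRealize U S φ (fun q => a (j q.1) q.2)

/-- An `A`-indiscernible sequence of `n`-tuples. -/
def IndiscOver {n : ℕ} (A : Set U) {I : Type*} [LinearOrder I] (a : I → Fin n → U) : Prop :=
  IndiscIn U (addConsts U iS A) a

/-- `D` is Lascar invariant over `A` : `D` is invariant over every small model containing `A`. -/
def LascarInv {n : ℕ} (A : Set U) (D : Set (Fin n → U)) : Prop :=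
  ∀ M : L.ElementarySubstructure U, A ⊆ (M : L.Substructure U) →
    #((M : L.Substructure U) : Set U) < #U →
    ∀ f ∈ AutFix L U ((M : L.Substructure U) : Set U), imgSet L U f D = D

/-- The cardinality of the set `L(A)` of formulas with parameters in `A`. -/
def formulaCard (A : Set U) : Cardinal.{u} :=
  #(Σ k : ℕ, (L[[↥A]]).Formula (Fin k))

/-- `u` locally covers `B` (relative to the cardinal `κ`). -/
def LocallyCovers {α : Type u} (κ : Cardinal.{u}) (u : Set (Set α)) (B : Set α) : Prop :=
  ∀ K : Set α, K ⊆ B → #K = κ → ∀ k : ℕ, ∃ D ∈ u, (k : Cardinal.{u}) ≤ #(↥(K ∩ D))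

/-- `φ(x, b)` divides over `A` : for some infinite `K ⊆ o(b/A)` and some `k`,
`{φ(x,c) : c ∈ K}` is `k`-inconsistent. -/
def Divides {m n : ℕ} (φ : L.Formula (Fin m ⊕ Fin n)) (b : Fin n → U) (A : Set U) : Prop :=
  ∃ K : Set (Fin n → U), K ⊆ oTuple L U A b ∧ K.Infinite ∧
    ∃ k : ℕ, ∀ s : Finset (Fin n → U), ↑s ⊆ K → s.card = k →
      ¬∃ x : Fin m → U, ∀ c ∈ s, φ.Realize (Sum.elim x c)

/-- `C` is pseudo-invariant over `A` : `e(C)` locally covers `o(b/A)` for every `b ∈ C`. -/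
def PseudoInv {k : ℕ} (A : Set U) (C : Set (Fin k → U)) : Prop :=
  ∀ b ∈ C, LocallyCovers (#U) (eSet L U (∅ : Set U) C) (oTuple L U A b)

/-- A family `u` of subsets of `U^n` is closed: it is cut out by a set of sentences with a
second-order variable, i.e. sentences of the language expanded by a predicate. -/
def ClosedFam {n : ℕ} (u : Set (Set (Fin n → U))) : Prop :=
  ∃ p : Set ((expLang L n).Sentence),
    u = {D | ∀ φ ∈ p, SentRealize U (expStr L U D) φ}

/-- `κ` is a Ramsey cardinal : every `2`-coloring of the finite subsets of a set of size `κ`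
has a homogeneous set of size `κ`. -/
def IsRamseyCard (κ : Cardinal.{u}) : Prop :=
  ∀ (X : Type u), #X = κ → ∀ c : Finset X → Bool,
    ∃ H : Set X, #H = κ ∧
      ∀ s t : Finset X, ↑s ⊆ H → ↑t ⊆ H → s.card = t.card → c s = c t

/-- The formula `φ(x,z)` is NIP: the family of its instances `φ(a,U)` has finite
VC dimension. -/
def FormulaNIP {m n : ℕ} (φ : L.Formula (Fin m ⊕ Fin n)) : Prop :=
  FiniteVC {E : Set (Fin n → U) | ∃ b : Fin m → U, E = phiSet L U φ b}

/-- The theory of `U` is NIP: every formula is NIP. -/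
def TheoryNIP : Prop :=
  ∀ (m n : ℕ) (φ : L.Formula (Fin m ⊕ Fin n)), FormulaNIP L U φ

/-- A global type `p(z)` is invariant over `A` : each of the sets `D_{p,φ}` is fixed
(setwise) by every automorphism fixing `A` pointwise. -/
def GlobalTypeInv {n : ℕ} (A : Set U) (p : Set ((L[[U]]).Formula (Fin n))) : Prop :=
  ∀ (k : ℕ) (φ : L.Formula (Fin n ⊕ Fin k)) (f : U ≃[L] U), f ∈ AutFix L U A →
    imgSet L U f {a | instFormula L U φ a ∈ p} = {a | instFormula L U φ a ∈ p}

/-- `M` (a subset of `U`) is `L(A;C)`-saturated : every finitely realized type `p(x) ⊆ L(A;C)`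
is realized by a tuple from `M`. -/
def LACSat {n : ℕ} (C : Set (Fin n → U)) (A : Set U) (M : Set U) : Prop :=
  ∀ (m : ℕ) (p : Set (((expLang L n)[[↥A]]).Formula (Fin m))),
    (∀ s : Finset (((expLang L n)[[↥A]]).Formula (Fin m)), ↑s ⊆ p →
      ∃ b : Fin m → U, ∀ φ ∈ s, FRealize U (addConsts U (expStr L U C) A) φ b) →
    ∃ b : Fin m → U, (∀ i, b i ∈ M) ∧
      ∀ φ ∈ p, FRealize U (addConsts U (expStr L U C) A) φ b

/-- The inclusion of languages `L(M) → L(U)` for `M : Set U`. -/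
def liftConsts (M : Set U) : (L[[↥M]]) →ᴸ (L[[U]]) :=
  LHom.sumMap (LHom.id L) (LHom.constantsOnMap Subtype.val)

/-- Two assignments `x : X → M` and `y : X → N` satisfy the same formulas. -/
def SameType (L : FirstOrder.Language.{u, u}) {M N : Type u} [L.Structure M] [L.Structure N]
    {X : Type u} (x : X → M) (y : X → N) : Prop :=
  ∀ φ : L.Formula X, φ.Realize x ↔ φ.Realize y

/-- `κ`-saturation, phrased with assignments in place of constants: every finitely realized
type in finitely many variables over fewer than `κ` parameters is realized. -/
def KSat (κ : Cardinal.{u}) (L : FirstOrder.Language.{u, u}) (M : Type u) [L.Structure M] : Prop :=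
  ∀ (X : Type u), #X < κ → ∀ (x : X → M) (m : ℕ) (q : Set (L.Formula (X ⊕ Fin m))),
    (∀ s : Finset (L.Formula (X ⊕ Fin m)), ↑s ⊆ q →
      ∃ b : Fin m → M, ∀ φ ∈ s, φ.Realize (Sum.elim x b)) →
    ∃ b : Fin m → M, ∀ φ ∈ q, φ.Realize (Sum.elim x b)

theorem realize_constantsVarsEquiv_addConsts {L : FirstOrder.Language.{u, u}} {M : Type u}
    (S : L.Structure M) (A : Set M) {β : Type*} (φ : (L[[↥A]]).Formula β) (b : β → M) :
    FRealize M S (BoundedFormula.constantsVarsEquiv φ : L.Formula (↥A ⊕ β))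
      (Sum.elim Subtype.val b) ↔ FRealize M (addConsts M S A) φ b := by
  let := S
  let : (constantsOn ↥A).Structure M := constantsOn.structure Subtype.val
  exact BoundedFormula.realize_constantsVarsEquiv (L := L) (M := M) (α := ↥A)

theorem isSatStr_iff_kSat {L : FirstOrder.Language.{u, u}} {M : Type u} (S : L.Structure M) :
    IsSatStr M S ↔ KSat #M L M := by
  classical
  constructor
  · intro h X hX x m q hq
    have hA : #(Set.range x) < #M := mk_range_le.trans_lt hX
    let g : X ⊕ Fin m → ↥(Set.range x) ⊕ Fin m := Sum.map (Set.rangeFactorization x) id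
    let t : L.Formula (X ⊕ Fin m) → (L[[↥(Set.range x)]]).Formula (Fin m) := fun φ =>
      BoundedFormula.constantsVarsEquiv.symm (Formula.relabel g φ)
    have ht : ∀ φ b, FRealize M (addConsts M S (Set.range x)) (t φ) b ↔
        φ.Realize (Sum.elim x b) := by
      intro φ b
      rw [← realize_constantsVarsEquiv_addConsts]
      simp only [t, Equiv.apply_symm_apply, FRealize, Formula.realize_relabel]
      have : Sum.elim Subtype.val b ∘ g = Sum.elim x b := by
        ext (i | i) <;> simp [g]
      rw [this]
    obtain ⟨b, hb⟩ := h _ hA m (t '' q) (by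
      intro s hs
      obtain ⟨s', hs', rfl⟩ := Finset.subset_set_image_iff.1 hs
      obtain ⟨b, hb⟩ := hq s' hs'
      exact ⟨b, fun φ hφ => by
        obtain ⟨ψ, hψ, rfl⟩ := Finset.mem_image.1 hφ
        exact (ht _ _).2 (hb ψ hψ)⟩)
    exact ⟨b, fun φ hφ => (ht _ _).1 (hb _ ⟨φ, hφ, rfl⟩)⟩
  · intro h A hA m p hp
    let t : (L[[↥A]]).Formula (Fin m) → L.Formula (↥A ⊕ Fin m) :=
      fun φ => BoundedFormula.constantsVarsEquiv φ
    have ht : ∀ φ b, FRealize M (addConsts M S A) φ b ↔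
        (t φ).Realize (Sum.elim Subtype.val b) := fun φ b =>
      (realize_constantsVarsEquiv_addConsts S A φ b).symm
    obtain ⟨b, hb⟩ := h A hA Subtype.val m (t '' p) (by
      intro s hs
      obtain ⟨s', hs', rfl⟩ := Finset.subset_set_image_iff.1 hs
      obtain ⟨b, hb⟩ := hp s' hs'
      exact ⟨b, fun φ hφ => by
        obtain ⟨ψ, hψ, rfl⟩ := Finset.mem_image.1 hφ
        exact (ht _ _).1 (hb ψ hψ)⟩)
    exact ⟨b, fun φ hφ => (ht _ _).2 (hb _ ⟨φ, hφ, rfl⟩)⟩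

theorem realize_equivSentence_addConsts {L : FirstOrder.Language.{u, u}} {M : Type u}
    (S : L.Structure M) (A : Set M) (φ : (L[[↥A]]).Sentence) :
    (Formula.equivSentence.symm φ).Realize (Subtype.val : ↥A → M) ↔
      SentRealize M (addConsts M S A) φ :=
  Formula.realize_equivSentence_symm M φ _

theorem eqvOver_iff_sameType {L : FirstOrder.Language.{u, u}} {U : Type u} [L.Structure U]
    {n : ℕ} {A : Set U} {C D : Set (Fin n → U)} :
    EqvOver L U A C D ↔ @SameType (expLang L n) U U (expStr L U C) (expStr L U D) ↥A
      Subtype.val Subtype.val := by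
  unfold EqvOver SameType
  simp only [← realize_equivSentence_addConsts]
  exact ⟨fun h φ => by simpa using h (Formula.equivSentence φ), fun h φ => h _⟩

theorem SameType.symm {L : FirstOrder.Language.{u, u}} {M N : Type u} [L.Structure M]
    [L.Structure N] {X : Type u} {x : X → M} {y : X → N} (h : SameType L x y) : SameType L y x :=
  fun φ => (h φ).symm

theorem exists_realize_iff_iExs {L : FirstOrder.Language.{u, u}} {M : Type u} [L.Structure M]
    {X : Type u} {F : Type*} [Finite F] (s : Finset (L.Formula (X ⊕ F))) (x : X → M) :
    (Formula.iExs F (Formula.iInf (fun φ : s => φ.1))).Realize x ↔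
      ∃ b : F → M, ∀ φ ∈ s, φ.Realize (Sum.elim x b) := by
  simp [Formula.realize_iExs, Formula.realize_iInf]

/-- The forth step: a finite tuple over a small assignment has a counterpart. -/
theorem SameType.exists_extend {κ : Cardinal.{u}} {L : FirstOrder.Language.{u, u}} {M N : Type u}
    [L.Structure M] [L.Structure N] (hN : KSat κ L N) {X : Type u} (hX : #X < κ)
    {x : X → M} {y : X → N} (h : SameType L x y) {F : Type u} [Finite F] (c : F → M) :
    ∃ d : F → N, SameType L (Sum.elim x c) (Sum.elim y d) := by
  classical
  obtain ⟨m, ⟨e⟩⟩ := Finite.exists_equiv_fin F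
  let q : Set (L.Formula (X ⊕ Fin m)) := {φ | φ.Realize (Sum.elim x (c ∘ e.symm))}
  obtain ⟨b, hb⟩ := hN X hX y m q (by
    intro s hs
    rw [← exists_realize_iff_iExs, ← h, exists_realize_iff_iExs]
    exact ⟨c ∘ e.symm, fun φ hφ => hs hφ⟩)
  have key : ∀ φ : L.Formula (X ⊕ Fin m), φ.Realize (Sum.elim x (c ∘ e.symm)) ↔
      φ.Realize (Sum.elim y b) := by
    intro φ
    refine ⟨fun hφ => hb φ hφ, fun hφ => ?_⟩
    by_contra hn
    exact Formula.realize_not.1 (hb φ.not (Formula.realize_not.2 hn)) hφ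
  refine ⟨b ∘ e, fun φ => ?_⟩
  have := key (φ.relabel (Sum.map id e))
  simp only [Formula.realize_relabel, Sum.elim_comp_map, Function.comp_id, Function.comp_assoc,
    Equiv.symm_comp_self] at this
  exact this

theorem SameType.exists_equiv_of_surjective {L : FirstOrder.Language.{u, u}} {M N : Type u}
    [L.Structure M] [L.Structure N] {X : Type u} {x : X → M} {y : X → N} (h : SameType L x y)
    (hx : Function.Surjective x) (hy : Function.Surjective y) :
    ∃ f : M ≃[L] N, ∀ i, f (x i) = y i := by
  obtain ⟨s, hs⟩ := hx.hasRightInverse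
  obtain ⟨t, ht⟩ := hy.hasRightInverse
  have heq : ∀ i j, x i = x j ↔ y i = y j := fun i j => by
    simpa using h ((Term.var i : L.Term X).equal (Term.var j))
  have hf : ∀ i, y (s (x i)) = y i := fun i => (heq _ _).1 (hs (x i))
  refine ⟨{ toFun := fun a => y (s a), invFun := fun b => x (t b), left_inv := ?_,
            right_inv := ?_, map_fun' := ?_, map_rel' := ?_ }, hf⟩
  · intro a
    exact ((heq _ _).2 (ht _)).trans (hs a)
  · intro b
    exact (hf _).trans (ht b)
  · intro n g xs
    have := (h ((Term.func g fun i => Term.var (s (xs i))).equal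
      (Term.var (s (Structure.funMap g xs))))).1 (by simp [hs _])
    simpa [Function.comp_def] using this.symm
  · intro n r xs
    have := h (r.formula fun i => Term.var (s (xs i)))
    simp only [Formula.realize_rel, Term.realize_var, hs _] at this
    exact this.symm

theorem sameType_of_forall_lt {L : FirstOrder.Language.{u, u}} {M N : Type u}
    [L.Structure M] [L.Structure N] {X I : Type u} [LinearOrder I] {x : X → M} {y : X → N}
    (h : SameType L x y) {a : I → M} {b : I → N} (S : Set I)
    (hS : ∀ i ∈ S, SameType L
      (Sum.elim (Sum.elim x fun j : Set.Iio i => a j) fun _ : PUnit.{u + 1} => a i)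
      (Sum.elim (Sum.elim y fun j : Set.Iio i => b j) fun _ : PUnit.{u + 1} => b i)) :
    SameType L (Sum.elim x fun j : S => a j) (Sum.elim y fun j : S => b j) := by
  classical
  intro φ
  let t : Finset S := φ.freeVarFinset.toRight
  have ht : ∀ i, Sum.inr i ∈ φ.freeVarFinset ↔ i ∈ t := fun i => by simp [t]
  rcases t.eq_empty_or_nonempty with h0 | hne
  · let g : φ.freeVarFinset → X := fun w => match w with
      | ⟨Sum.inl z, _⟩ => z
      | ⟨Sum.inr i, hi⟩ => absurd ((ht i).1 hi) (by simp [h0])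
    have key := h (φ.restrictFreeVar g)
    rw [Formula.Realize, Formula.Realize] at key
    rwa [BoundedFormula.realize_restrictFreeVar (Sum.elim x fun j : S => a j),
      BoundedFormula.realize_restrictFreeVar (Sum.elim y fun j : S => b j)] at key
    all_goals
      rintro ⟨z | i, hi⟩
      · rfl
      · exact absurd ((ht i).1 hi) (by simp [h0])
  · let m := t.max' hne
    let g : φ.freeVarFinset → (X ⊕ Set.Iio m.1) ⊕ PUnit.{u + 1} := fun w => match w.1 with
      | Sum.inl z => Sum.inl (Sum.inl z)
      | Sum.inr i => if hi : i.1 < m.1 then Sum.inl (Sum.inr ⟨i.1, hi⟩) else Sum.inr PUnit.unit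
    have hm : ∀ i, Sum.inr i ∈ φ.freeVarFinset → ¬ i.1 < m.1 → i = m := fun i hi hlt =>
      le_antisymm (t.le_max' i ((ht i).1 hi)) (not_lt.1 hlt)
    have key := hS m.1 m.2 (φ.restrictFreeVar g)
    rw [Formula.Realize, Formula.Realize] at key
    rwa [BoundedFormula.realize_restrictFreeVar (Sum.elim x fun j : S => a j),
      BoundedFormula.realize_restrictFreeVar (Sum.elim y fun j : S => b j)] at key
    all_goals
      rintro ⟨z | i, hi⟩
      · rfl
      · by_cases hlt : i.1 < m.1
        · simp only [g, dif_pos hlt, Sum.elim_inl, Sum.elim_inr]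
        · simp [g, hm i hi hlt]

theorem mk_Iio_lt_of_ord {κ : Cardinal.{u}} (i : κ.ord.ToType) : #(Set.Iio i) < κ := by
  simpa using mk_Iio_lt i

/-- Back and forth between two saturated structures of the same infinite cardinality. -/
theorem SameType.exists_equiv {κ : Cardinal.{u}} (hκ : ℵ₀ ≤ κ) {L : FirstOrder.Language.{u, u}}
    {M N : Type u} [L.Structure M] [L.Structure N] [Nonempty M] (hM : KSat κ L M)
    (hN : KSat κ L N) (hMκ : #M ≤ κ) (hNκ : #N ≤ κ) {X : Type u} (hX : #X < κ)
    {x : X → M} {y : X → N} (h : SameType L x y) :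
    ∃ f : M ≃[L] N, ∀ i, f (x i) = y i := by
  classical
  let I := κ.ord.ToType
  have hI : #I = κ := mk_ord_toType κ
  obtain ⟨e, he⟩ : ∃ e : I → M ⊕ N, Function.Surjective e := by
    have hle : #(M ⊕ N) ≤ #I := by
      rw [mk_sum, lift_id, lift_id, hI]
      exact add_le_of_le hκ hMκ hNκ
    exact ⟨_, Function.invFun_surjective hle.some.injective⟩
  let P : ∀ i : I, (Set.Iio i → M × N) → M × N → Prop := fun i g p =>
    (∀ m, e i = Sum.inl m → p.1 = m) ∧ (∀ n, e i = Sum.inr n → p.2 = n) ∧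
      SameType L (Sum.elim (Sum.elim x fun j => (g j).1) fun _ : PUnit.{u + 1} => p.1)
        (Sum.elim (Sum.elim y fun j => (g j).2) fun _ : PUnit.{u + 1} => p.2)
  have hP : ∀ i g, SameType L (Sum.elim x fun j => (g j).1) (Sum.elim y fun j => (g j).2) →
      ∃ p, P i g p := by
    intro i g hg
    have hc : #(X ⊕ Set.Iio i) < κ := by
      rw [mk_sum, lift_id, lift_id]
      exact add_lt_of_lt hκ hX (mk_Iio_lt_of_ord i)
    rcases hi : e i with m | n
    · obtain ⟨d, hd⟩ := hg.exists_extend hN hc fun _ : PUnit.{u + 1} => m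
      exact ⟨(m, d PUnit.unit), by simp [hi], by simp [hi], hd⟩
    · obtain ⟨d, hd⟩ := hg.symm.exists_extend hM hc fun _ : PUnit.{u + 1} => n
      exact ⟨(d PUnit.unit, n), by simp [hi], by simp [hi], hd.symm⟩
  have : Nonempty (M × N) := by
    obtain ⟨m⟩ := ‹Nonempty M›
    obtain ⟨d, -⟩ := h.exists_extend hN hX fun _ : PUnit.{u + 1} => m
    exact ⟨(m, d PUnit.unit)⟩
  let F : ∀ i : I, (∀ j : I, j < i → M × N) → M × N := fun i g =>
    Classical.epsilon (P i fun j => g j.1 j.2)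
  let G : I → M × N := (wellFounded_lt (α := I)).fix F
  have hG : ∀ i, G i = Classical.epsilon (P i fun j => G j) := fun i =>
    (wellFounded_lt (α := I)).fix_eq F i
  have main : ∀ i, P i (fun j => G j) (G i) := by
    intro i
    induction i using (wellFounded_lt (α := I)).induction with
    | _ i ih =>
      have hS := sameType_of_forall_lt h (a := fun i => (G i).1) (b := fun i => (G i).2)
        (Set.Iio i) fun j hj => (ih j hj).2.2
      have := Classical.epsilon_spec (hP i (fun j => G j) hS)
      rwa [← hG] at this
  have hall := sameType_of_forall_lt h (a := fun i => (G i).1) (b := fun i => (G i).2)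
    Set.univ fun j _ => (main j).2.2
  obtain ⟨f, hf⟩ := hall.exists_equiv_of_surjective
    (fun m => by
      obtain ⟨i, hi⟩ := he (Sum.inl m)
      exact ⟨Sum.inr ⟨i, trivial⟩, (main i).1 m hi⟩)
    (fun n => by
      obtain ⟨i, hi⟩ := he (Sum.inr n)
      exact ⟨Sum.inr ⟨i, trivial⟩, (main i).2.1 n hi⟩)
  exact ⟨f, fun i => hf (Sum.inl i)⟩

/-- A set of formulas is realized by some assignment in some structure. -/
def Realizable (L : FirstOrder.Language.{u, u}) {W : Type u} (Γ : Set (L.Formula W)) : Prop :=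
  ∃ (M : Type u) (_ : L.Structure M) (v : W → M), Nonempty M ∧ ∀ φ ∈ Γ, φ.Realize v

theorem Realizable.mono {L : FirstOrder.Language.{u, u}} {W : Type u} {Γ Δ : Set (L.Formula W)}
    (h : Realizable L Δ) (hs : Γ ⊆ Δ) : Realizable L Γ :=
  let ⟨M, i, v, hM, hv⟩ := h
  ⟨M, i, v, hM, fun φ hφ => hv φ (hs hφ)⟩

theorem realizable_iff_isSatisfiable {L : FirstOrder.Language.{u, u}} {W : Type u}
    {Γ : Set (L.Formula W)} :
    Realizable L Γ ↔ Theory.IsSatisfiable (Formula.equivSentence '' Γ : (L[[W]]).Theory) := by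
  constructor
  · rintro ⟨M, i, v, hM, hv⟩
    let : (constantsOn W).Structure M := constantsOn.structure v
    have : M ⊨ (Formula.equivSentence '' Γ : (L[[W]]).Theory) := by
      refine ⟨?_⟩
      rintro _ ⟨φ, hφ, rfl⟩
      exact (Formula.realize_equivSentence M φ).2 (hv φ hφ)
    exact Theory.Model.isSatisfiable M
  · rintro ⟨M⟩
    let := (L.lhomWithConstants W).reduct M
    refine ⟨M, inferInstance, fun a => (L.con a : M), inferInstance, fun φ hφ => ?_⟩
    exact (Formula.realize_equivSentence M φ).1
      (Theory.realize_sentence_of_mem (Formula.equivSentence '' Γ) (Set.mem_image_of_mem _ hφ))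

theorem realizable_of_finset {L : FirstOrder.Language.{u, u}} {W : Type u}
    {Γ : Set (L.Formula W)}
    (h : ∀ s : Finset (L.Formula W), ↑s ⊆ Γ → Realizable L (↑s : Set (L.Formula W))) :
    Realizable L Γ := by
  classical
  rw [realizable_iff_isSatisfiable, Theory.isSatisfiable_iff_isFinitelySatisfiable]
  intro s hs
  obtain ⟨s', hs', rfl⟩ := Finset.subset_set_image_iff.1 hs
  have := realizable_iff_isSatisfiable.1 (h s' hs')
  simpa using this

theorem realizable_union_biUnion {L : FirstOrder.Language.{u, u}} {W I : Type u} [LinearOrder I]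
    {Γ : Set (L.Formula W)} (hΓ : Realizable L Γ) (Δ : I → Set (L.Formula W)) (S : Set I)
    (h : ∀ i ∈ S, Realizable L (Γ ∪ ⋃ j ≤ i, Δ j)) : Realizable L (Γ ∪ ⋃ j ∈ S, Δ j) := by
  classical
  refine realizable_of_finset fun s hs => ?_
  have : ↑s ⊆ Γ ∨ ∃ i ∈ S, ↑s ⊆ Γ ∪ ⋃ j ≤ i, Δ j := by
    induction s using Finset.induction_on with
    | empty => simp
    | insert φ s _ ih =>
      rw [Finset.coe_insert, Set.insert_subset_iff] at hs
      have hmono : ∀ i k, i ≤ k → (Γ ∪ ⋃ j ≤ i, Δ j) ⊆ Γ ∪ ⋃ j ≤ k, Δ j := fun i k hik =>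
        Set.union_subset_union_right _
          (Set.biUnion_subset_biUnion_left fun j hj => le_trans hj hik)
      rw [Finset.coe_insert]
      simp only [Set.insert_subset_iff]
      rcases hs.1 with hφ | hφ
      · rcases ih hs.2 with h1 | ⟨i, hi, h1⟩
        · exact Or.inl ⟨hφ, h1⟩
        · exact Or.inr ⟨i, hi, Or.inl hφ, h1⟩
      · simp only [Set.mem_iUnion] at hφ
        obtain ⟨k, hk, hφ⟩ := hφ
        have hφk : ∀ i, k ≤ i → φ ∈ Γ ∪ ⋃ j ≤ i, Δ j := fun i hi =>
          Or.inr (Set.mem_biUnion hi hφ)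
        rcases ih hs.2 with h1 | ⟨i, hi, h1⟩
        · exact Or.inr ⟨k, hk, hφk k le_rfl, h1.trans Set.subset_union_left⟩
        · rcases le_total i k with hik | hik
          · exact Or.inr ⟨k, hk, hφk k le_rfl, h1.trans (hmono _ _ hik)⟩
          · exact Or.inr ⟨i, hi, hφk i hik, h1⟩
  rcases this with h1 | ⟨i, hi, h1⟩
  · exact hΓ.mono h1
  · exact (h i hi).mono h1

theorem exists_forall_lt_of_mk_lt {κ : Cardinal.{u}} (hκ : κ.IsRegular) {X : Type u} (hX : #X < κ)
    (g : X → κ.ord.ToType) : ∃ i, ∀ z, g z < i := by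
  by_contra! hcon
  have h1 : (⋃ z, Set.Iic (g z)) = Set.univ :=
    Set.eq_univ_of_forall fun i => Set.mem_iUnion.2 (hcon i)
  have h2 := (card_iUnion_lt_iff_forall_of_isRegular (t := fun z => Set.Iic (g z)) hκ hX).2
    fun z => by
      rw [← Set.Iio_insert]
      exact mk_insert_le.trans_lt (add_lt_of_lt hκ.aleph0_le (mk_Iio_lt_of_ord _)
        (one_lt_aleph0.trans_le hκ.aleph0_le))
  rw [h1, mk_univ, mk_ord_toType] at h2
  exact lt_irrefl _ h2

theorem mk_formula_lt {κ : Cardinal.{u}} (hκ : ℵ₀ < κ) {L : FirstOrder.Language.{u, u}}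
    (hL : L.card < κ) {W : Type u} (hW : #W < κ) : #(L.Formula W) < κ := by
  have h1 : #(L.Formula W) ≤ #(Σ n, L.BoundedFormula W n) :=
    mk_le_of_injective (f := fun φ => (⟨0, φ⟩ : Σ n, L.BoundedFormula W n)) fun a b h => by
      simpa using h
  refine (h1.trans BoundedFormula.card_le).trans_lt (max_lt hκ ?_)
  simpa using add_lt_of_lt hκ.le hW hL

/-- An enumeration of length `κ` in which every element of a nonempty set of size at most `κ`
occurs cofinally often. -/
theorem exists_cofinal_enumeration {κ : Cardinal.{u}} (hκ : ℵ₀ ≤ κ) {Q : Type u} [Nonempty Q]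
    (hQ : #Q ≤ κ) : ∃ e : κ.ord.ToType → Q, ∀ q i, ∃ j, i ≤ j ∧ e j = q := by
  have : Nonempty κ.ord.ToType := by
    rw [← mk_ne_zero_iff, mk_ord_toType]
    exact (aleph0_pos.trans_le hκ).ne'
  have hle : #(κ.ord.ToType × Q) ≤ #κ.ord.ToType := by
    rw [mk_prod, lift_id, lift_id, mk_ord_toType]
    exact mul_le_of_le hκ le_rfl hQ
  obtain ⟨e, he⟩ : ∃ e : κ.ord.ToType → κ.ord.ToType × Q, Function.Surjective e :=
    ⟨_, Function.invFun_surjective hle.some.injective⟩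
  refine ⟨fun i => (e i).2, fun q i => ?_⟩
  by_contra! hcon
  choose s hs using fun j => he (j, q)
  have hlt : ∀ j, s j < i := fun j => not_le.1 fun hij => hcon _ hij (by rw [hs])
  have : #κ.ord.ToType ≤ #(Set.Iio i) :=
    mk_le_of_injective (f := fun j => (⟨s j, hlt j⟩ : Set.Iio i)) fun a b hab => by
      have h1 : s a = s b := congrArg Subtype.val hab
      have := congrArg e h1
      rw [hs, hs] at this
      exact congrArg Prod.fst this
  rw [mk_ord_toType] at this
  exact this.not_gt (mk_Iio_lt_of_ord i)

/-- Given sets of formulas indexed by a well-order, add each one in turn if it is consistent with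
what has been added before. -/
theorem Realizable.exists_greedy {L : FirstOrder.Language.{u, u}} {W I : Type u} [LinearOrder I]
    [WellFoundedLT I] {Γ : Set (L.Formula W)} (hΓ : Realizable L Γ) (Q : I → Set (L.Formula W)) :
    ∃ Δ : I → Set (L.Formula W), (∀ i, Δ i ⊆ Q i) ∧ Realizable L (Γ ∪ ⋃ i, Δ i) ∧
      ∀ i, Realizable L ((Γ ∪ ⋃ j < i, Δ j) ∪ Q i) → Q i ⊆ Δ i := by
  let F : ∀ i : I, (∀ j : I, j < i → Set (L.Formula W)) → Set (L.Formula W) := fun i g =>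
    {φ ∈ Q i | Realizable L ((Γ ∪ ⋃ (j) (h : j < i), g j h) ∪ Q i)}
  let Δ : I → Set (L.Formula W) := (wellFounded_lt (α := I)).fix F
  have hΔ : ∀ i, Δ i = {φ ∈ Q i | Realizable L ((Γ ∪ ⋃ j < i, Δ j) ∪ Q i)} := fun i =>
    (wellFounded_lt (α := I)).fix_eq F i
  have main : ∀ i, Realizable L (Γ ∪ ⋃ j ≤ i, Δ j) := by
    intro i
    induction i using (wellFounded_lt (α := I)).induction with
    | _ i ih =>
      have hlt : Realizable L (Γ ∪ ⋃ j < i, Δ j) := realizable_union_biUnion hΓ Δ (Set.Iio i) ih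
      by_cases hi : Realizable L ((Γ ∪ ⋃ j < i, Δ j) ∪ Q i)
      · refine hi.mono (Set.union_subset (Set.subset_union_left.trans Set.subset_union_left) ?_)
        refine Set.iUnion₂_subset fun j hj => ?_
        rcases hj.lt_or_eq with hj | rfl
        · exact (Set.subset_biUnion_of_mem (u := Δ) (show j ∈ Set.Iio i from hj)).trans
            (Set.subset_union_right.trans Set.subset_union_left)
        · rw [hΔ]
          exact fun φ hφ => Or.inr hφ.1
      · refine hlt.mono (Set.union_subset Set.subset_union_left ?_)
        refine Set.iUnion₂_subset fun j hj => ?_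
        rcases hj.lt_or_eq with hj | rfl
        · exact (Set.subset_biUnion_of_mem (u := Δ) (show j ∈ Set.Iio i from hj)).trans
            Set.subset_union_right
        · rw [hΔ]
          exact fun φ hφ => absurd hφ.2 hi
  refine ⟨Δ, fun i => ?_, ?_, fun i hi => ?_⟩
  · rw [hΔ]
    exact fun φ hφ => hφ.1
  · simpa using realizable_union_biUnion hΓ Δ Set.univ fun i _ => main i
  · rw [hΔ i]
    exact fun φ hφ => ⟨hφ, hi⟩

/-- A model together with a small set of names such that every type over fewer than `κ` named
parameters is realized by named elements. -/
theorem exists_named_witnesses {κ : Cardinal.{u}} (hκ : IsInaccessible κ)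
    {L : FirstOrder.Language.{u, u}} (hL : L.card < κ) {M₀ : Type u} [L.Structure M₀]
    [Nonempty M₀] {J : Type u} (hJ : #J < κ) (x : J → M₀) :
    ∃ (M : Type u) (_ : L.Structure M) (W : Type u) (v : W → M) (y : J → W), Nonempty M ∧
      #W ≤ κ ∧ SameType L x (v ∘ y) ∧
      ∀ X : Type u, #X < κ → ∀ (w : X → W) (q : Set (L.Formula (X ⊕ ℕ))),
        (∀ s : Finset (L.Formula (X ⊕ ℕ)), ↑s ⊆ q →
          ∃ b : ℕ → M, ∀ φ ∈ s, φ.Realize (Sum.elim (v ∘ w) b)) →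
        ∃ b : ℕ → W, ∀ φ ∈ q, φ.Realize (Sum.elim (v ∘ w) (v ∘ b)) := by
  classical
  have hω : ℵ₀ < κ := hκ.aleph0_lt
  let I := κ.ord.ToType
  let Z : I → Type u := fun β => J ⊕ (Set.Iio β × ℕ)
  let W := J ⊕ (I × ℕ)
  let Q := Σ β : I, Set (L.Formula (Z β ⊕ ℕ))
  have hZ : ∀ β, #(Z β) < κ := fun β => by
    simp only [Z, mk_sum, mk_prod, lift_id, mk_nat, lift_aleph0, Cardinal.lift_uzero]
    exact add_lt_of_lt hω.le hJ (mul_lt_of_lt hω.le (mk_Iio_lt_of_ord β) hω)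
  have hW : #W ≤ κ := by
    simp only [W, I, mk_sum, mk_prod, lift_id, mk_nat, lift_aleph0, mk_ord_toType,
      Cardinal.lift_uzero]
    exact add_le_of_le hω.le hJ.le (mul_le_of_le hω.le le_rfl hω.le)
  have hQ : #Q ≤ κ := by
    have h1 : ∀ β, #(Set (L.Formula (Z β ⊕ ℕ))) ≤ κ := fun β => by
      rw [mk_set]
      refine (hκ.isStrongPrelimit (mk_formula_lt hω hL ?_)).le
      simp only [mk_sum, mk_nat, lift_aleph0, Cardinal.lift_uzero]
      exact add_lt_of_lt hω.le (hZ β) hω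
    rw [mk_sigma]
    refine (sum_le_sum _ (fun _ => κ) h1).trans ?_
    rw [sum_const', mk_ord_toType]
    exact mul_le_of_le hω.le le_rfl le_rfl
  have hI : Nonempty I := by
    rw [← mk_ne_zero_iff, mk_ord_toType]
    exact (aleph0_pos.trans hω).ne'
  have : Nonempty Q := hI.map fun i => ⟨i, ∅⟩
  obtain ⟨e, he⟩ := exists_cofinal_enumeration hω.le hQ
  let emb : ∀ α β : I, Z β ⊕ ℕ → W := fun α β =>
    Sum.elim (Sum.elim Sum.inl fun p => Sum.inr (p.1.1, p.2)) fun k => Sum.inr (α, k)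
  let T' : I → Q → Set (L.Formula W) := fun α p =>
    {ψ | p.1 ≤ α ∧ ψ ∈ Formula.relabel (emb α p.1) '' p.2}
  let T : I → Set (L.Formula W) := fun α => T' α (e α)
  have hT : ∀ α, ∀ ψ ∈ T α, ∀ (M : Type u) [L.Structure M] (v v' : W → M),
      (∀ z, v (Sum.inl z) = v' (Sum.inl z)) →
      (∀ i k, i ≤ α → v (Sum.inr (i, k)) = v' (Sum.inr (i, k))) →
      ψ.Realize v → ψ.Realize v' := by
    rintro α _ ⟨hα, ψ, -, rfl⟩ M _ v v' h1 h2 h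
    rw [Formula.realize_relabel] at h ⊢
    convert h using 1
    ext ((z | ⟨i, k⟩) | k)
    · exact (h1 z).symm
    · exact (h2 i.1 k ((show i.1 < (e α).1 from i.2).le.trans hα)).symm
    · exact (h2 α k le_rfl).symm
  let Γ : Set (L.Formula W) := Formula.relabel Sum.inl '' {φ | φ.Realize x}
  have hΓ : Realizable L Γ := by
    obtain ⟨m⟩ := ‹Nonempty M₀›
    refine ⟨M₀, inferInstance, Sum.elim x fun _ => m, ⟨m⟩, ?_⟩
    rintro _ ⟨φ, hφ, rfl⟩
    rw [Formula.realize_relabel]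
    exact hφ
  obtain ⟨Δ, hΔT, ⟨M, iM, v, hM, hv⟩, hΔ⟩ := hΓ.exists_greedy T
  refine ⟨M, iM, W, v, Sum.inl, hM, hW, fun φ => ?_, fun X hX w q hq => ?_⟩
  · have h1 : ∀ φ : L.Formula J, φ.Realize x → φ.Realize (v ∘ Sum.inl) := fun φ hφ => by
      rw [← Formula.realize_relabel]
      exact hv _ (Or.inl ⟨φ, hφ, rfl⟩)
    refine ⟨h1 φ, fun hφ => ?_⟩
    by_contra hn
    exact Formula.realize_not.1 (h1 φ.not (Formula.realize_not.2 hn)) hφ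
  · obtain ⟨β, hβ⟩ := exists_forall_lt_of_mk_lt hκ.isRegular hX
      fun z => Sum.elim (fun _ => hI.some) Prod.fst (w z)
    have hw : ∀ z, ∃ z' : Z β, Sum.elim Sum.inl (fun p => Sum.inr (p.1.1, p.2)) z' = w z := by
      intro z
      have hz := hβ z
      generalize w z = a at hz
      rcases a with j | ⟨i, k⟩
      · exact ⟨Sum.inl j, rfl⟩
      · exact ⟨Sum.inr (⟨i, hz⟩, k), rfl⟩
    choose g hg using hw
    obtain ⟨α, hα, heα⟩ := he ⟨β, Formula.relabel (Sum.map g id) '' q⟩ β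
    have hTα : T α = T' α ⟨β, Formula.relabel (Sum.map g id) '' q⟩ := congrArg (T' α) heα
    have hreal : ∀ (φ : L.Formula (X ⊕ ℕ)) (v : W → M),
        ((φ.relabel (Sum.map g id)).relabel (emb α β)).Realize v ↔
          φ.Realize (Sum.elim (v ∘ w) fun k => v (Sum.inr (α, k))) := fun φ v => by
      rw [Formula.realize_relabel, Formula.realize_relabel]
      have : (v ∘ emb α β) ∘ Sum.map g id = Sum.elim (v ∘ w) fun k => v (Sum.inr (α, k)) := by
        ext (z | k)
        · exact congrArg v (hg z)
        · rfl
      rw [this]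
    have hall : T α ⊆ Δ α := by
      refine hΔ α (realizable_of_finset fun s hs => ?_)
      obtain ⟨s', hs', hss'⟩ : ∃ s' : Finset (L.Formula (X ⊕ ℕ)), ↑s' ⊆ q ∧
          ∀ ψ ∈ s, ψ ∈ T α → ∃ φ ∈ s',
            ψ = (φ.relabel (Sum.map g id)).relabel (emb α β) := by
        have h1 : ↑(s.filter (· ∈ T α)) ⊆
            (fun φ => Formula.relabel (emb α β) (Formula.relabel (Sum.map g id) φ)) '' q := by
          intro ψ hψ
          have := (Finset.mem_filter.1 hψ).2
          rw [hTα] at this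
          obtain ⟨-, _, ⟨φ, hφ, rfl⟩, rfl⟩ := this
          exact ⟨φ, hφ, rfl⟩
        obtain ⟨s', hs', h2⟩ := Finset.subset_set_image_iff.1 h1
        refine ⟨s', hs', fun ψ hψ hψT => ?_⟩
        have := Finset.mem_filter.2 ⟨hψ, hψT⟩
        rw [← h2] at this
        obtain ⟨φ, hφ, rfl⟩ := Finset.mem_image.1 this
        exact ⟨φ, hφ, rfl⟩
      obtain ⟨b, hb⟩ := hq s' hs'
      let v' : W → M := Sum.elim (v ∘ Sum.inl) fun p => if p.1 = α then b p.2 else v (Sum.inr p)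
      have hv' : ∀ i k, i < α → v (Sum.inr (i, k)) = v' (Sum.inr (i, k)) := fun i k hi => by
        simp [v', hi.ne]
      have hv'w : v' ∘ w = v ∘ w := by
        ext z
        rw [Function.comp_apply, Function.comp_apply, ← hg z]
        rcases g z with j | ⟨i, k⟩
        · rfl
        · exact (hv' i.1 k ((show i.1 < β from i.2).trans_le hα)).symm
      refine ⟨M, iM, v', hM, fun ψ hψ => ?_⟩
      rcases hs hψ with (hψΓ | hψΔ) | hψT
      · have hψ2 := hv ψ (Or.inl hψΓ)
        obtain ⟨φ, -, rfl⟩ := hψΓ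
        rw [Formula.realize_relabel] at hψ2 ⊢
        exact hψ2
      · simp only [Set.mem_iUnion] at hψΔ
        obtain ⟨j, hj, hψj⟩ := hψΔ
        exact hT j ψ (hΔT j hψj) M v v' (fun _ => rfl) (fun i k hi => hv' i k (hi.trans_lt hj))
          (hv _ (Or.inr (Set.mem_iUnion.2 ⟨j, hψj⟩)))
      · obtain ⟨φ, hφ, rfl⟩ := hss' ψ hψ hψT
        rw [hreal, hv'w]
        have : (fun k => v' (Sum.inr (α, k))) = b := by
          ext k
          simp [v']
        rw [this]
        exact hb φ hφ
    refine ⟨fun k => Sum.inr (α, k), fun φ hφ => ?_⟩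
    have h2 : (φ.relabel (Sum.map g id)).relabel (emb α β) ∈ T α := by
      rw [hTα]
      exact ⟨hα, _, ⟨φ, hφ, rfl⟩, rfl⟩
    exact (hreal φ v).1 (hv _ (Or.inr (Set.mem_iUnion.2 ⟨α, hall h2⟩)))

/-- Every structure with a small assignment can be replaced by a `κ`-saturated structure of
cardinality at most `κ`, for `κ` inaccessible. -/
theorem exists_kSat {κ : Cardinal.{u}} (hκ : IsInaccessible κ)
    {L : FirstOrder.Language.{u, u}} (hL : L.card < κ) {M₀ : Type u} [L.Structure M₀]
    [Nonempty M₀] {J : Type u} (hJ : #J < κ) (x : J → M₀) :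
    ∃ (N : Type u) (_ : L.Structure N) (y : J → N), SameType L x y ∧ KSat κ L N ∧ #N ≤ κ := by
  classical
  obtain ⟨M, iM, W, v, y, hM, hW, hxy, hwit⟩ := exists_named_witnesses hκ hL hJ x
  have hmeet : L.MeetsDefinable (Set.range v) := by
    rintro D ⟨a, ha⟩ hD
    obtain ⟨A₀, hA₀, hD⟩ := Set.definable_iff_finitely_definable.1 hD
    obtain ⟨φ, hφ⟩ := Set.definable_iff_exists_formula_sum.1 hD
    have hmem : ∀ c : Fin 1 → M, c 0 ∈ D ↔ φ.Realize (Sum.elim Subtype.val c) := fun c => by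
      have := Set.ext_iff.1 hφ c
      exact this
    choose w hw using fun z : (A₀ : Set M) => hA₀ z.2
    have hvw : v ∘ w = Subtype.val := funext hw
    have hreal : ∀ b : ℕ → M, (φ.relabel (Sum.map id Fin.val)).Realize (Sum.elim (v ∘ w) b) ↔
        b 0 ∈ D := fun b => by
      rw [Formula.realize_relabel, Sum.elim_comp_map, hvw, Function.comp_id, ← hmem]
      rfl
    obtain ⟨b, hb⟩ := hwit _ ((A₀.finite_toSet.lt_aleph0).trans hκ.aleph0_lt) w
      {φ.relabel (Sum.map id Fin.val)} fun s hs => ⟨fun _ => a, fun ψ hψ => by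
        rw [Set.mem_singleton_iff.1 (hs hψ), hreal]
        exact ha⟩
    exact ⟨v (b 0), (hreal _).1 (hb _ rfl), Set.mem_range_self _⟩
  let S := hmeet.toElementarySubstructure
  have hS : ∀ a, a ∈ S ↔ a ∈ Set.range v := fun a => Set.ext_iff.1 hmeet.closure_eq_self a
  have hSr : ∀ {α : Type u} (φ : L.Formula α) (c : α → S),
      φ.Realize (Subtype.val ∘ c) ↔ φ.Realize c := fun φ c => S.subtype.map_formula φ c
  refine ⟨S, inferInstance, fun j => ⟨v (y j), (hS _).2 (Set.mem_range_self _)⟩, fun φ => ?_, ?_,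
    ?_⟩
  · rw [hxy, ← hSr]
    rfl
  · intro X hX c m q hq
    choose w hw using fun z => (hS _).1 (c z).2
    have hvw : v ∘ w = Subtype.val ∘ c := funext hw
    have hreal : ∀ (φ : L.Formula (X ⊕ Fin m)) (b : ℕ → S),
        (φ.relabel (Sum.map id Fin.val)).Realize (Sum.elim (v ∘ w) (Subtype.val ∘ b)) ↔
          φ.Realize (Sum.elim c (b ∘ Fin.val)) := fun φ b => by
      rw [Formula.realize_relabel, hvw, ← Sum.comp_elim, Function.comp_assoc, hSr,
        Sum.elim_comp_map, Function.comp_id]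
    have : Nonempty S := by
      obtain ⟨b, -⟩ := hwit PEmpty (by simpa using hκ.pos) PEmpty.elim ∅ fun s hs =>
        ⟨fun _ => hM.some, fun φ hφ => (hs hφ).elim⟩
      exact ⟨⟨v (b 0), (hS _).2 (Set.mem_range_self _)⟩⟩
    obtain ⟨b, hb⟩ := hwit X hX w (Formula.relabel (Sum.map id Fin.val) '' q) (by
      intro s hs
      obtain ⟨s', hs', rfl⟩ := Finset.subset_set_image_iff.1 hs
      obtain ⟨b, hb⟩ := hq s' hs'
      refine ⟨Subtype.val ∘ fun k => if h : k < m then b ⟨k, h⟩ else Classical.arbitrary S,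
        fun φ hφ => ?_⟩
      obtain ⟨ψ, hψ, rfl⟩ := Finset.mem_image.1 hφ
      rw [hreal]
      convert hb ψ hψ using 2
      ext k
      simp)
    let b' : ℕ → S := fun k => ⟨v (b k), (hS _).2 (Set.mem_range_self _)⟩
    exact ⟨b' ∘ Fin.val, fun φ hφ => (hreal φ b').1 (hb _ ⟨φ, hφ, rfl⟩)⟩
  · have : #S ≤ #(Set.range v) := mk_le_mk_of_subset fun a ha => (hS a).1 ha
    exact this.trans (mk_range_le.trans hW)

/-- Equality of types passes to a reduct. -/
theorem SameType.reduct {L L' : FirstOrder.Language.{u, u}} (g : L →ᴸ L') {M N : Type u}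
    [L.Structure M] [L.Structure N] [L'.Structure M] [L'.Structure N] [g.IsExpansionOn M]
    [g.IsExpansionOn N] {X : Type u} {x : X → M} {y : X → N} (h : SameType L' x y) :
    SameType L x y := fun φ => by
  rw [← LHom.realize_onFormula g, h, LHom.realize_onFormula g]

/-- Saturation passes to a reduct. -/
theorem KSat.reduct {L L' : FirstOrder.Language.{u, u}} (g : L →ᴸ L') {κ : Cardinal.{u}}
    {M : Type u} [L.Structure M] [L'.Structure M] [g.IsExpansionOn M] (h : KSat κ L' M) :
    KSat κ L M := by
  classical
  intro X hX x m q hq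
  obtain ⟨b, hb⟩ := h X hX x m (g.onFormula '' q) (by
    intro s hs
    obtain ⟨s', hs', rfl⟩ := Finset.subset_set_image_iff.1 hs
    obtain ⟨b, hb⟩ := hq s' hs'
    refine ⟨b, fun φ hφ => ?_⟩
    obtain ⟨ψ, hψ, rfl⟩ := Finset.mem_image.1 hφ
    exact (LHom.realize_onFormula g ψ).2 (hb ψ hψ))
  exact ⟨b, fun φ hφ => (LHom.realize_onFormula g φ).1 (hb _ ⟨φ, hφ, rfl⟩)⟩

/-- Saturation is invariant under isomorphism. -/
theorem KSat.of_equiv {L : FirstOrder.Language.{u, u}} {κ : Cardinal.{u}} {M N : Type u}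
    [L.Structure M] [L.Structure N] (f : M ≃[L] N) (h : KSat κ L N) : KSat κ L M := by
  have hf : ∀ {α : Type u} (φ : L.Formula α) (c : α → M),
      φ.Realize (f ∘ c) ↔ φ.Realize c := fun φ c => StrongHomClass.realize_formula f φ
  intro X hX x m q hq
  obtain ⟨b, hb⟩ := h X hX (f ∘ x) m q fun s hs => by
    obtain ⟨b, hb⟩ := hq s hs
    refine ⟨f ∘ b, fun φ hφ => ?_⟩
    rw [← Sum.comp_elim, hf]
    exact hb φ hφ
  refine ⟨f.symm ∘ b, fun φ hφ => ?_⟩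
  rw [← hf, Sum.comp_elim]
  convert hb φ hφ using 2
  ext i
  simp

/-- The inclusion of `L` in its expansion by a new predicate. -/
def expHom (L : FirstOrder.Language.{u, u}) (n : ℕ) : L →ᴸ expLang L n := LHom.sumInl

theorem isExpansionOn_expStr {L : FirstOrder.Language.{u, u}} {U : Type u} [L.Structure U] {n : ℕ}
    (C : Set (Fin n → U)) :
    @LHom.IsExpansionOn L (expLang L n) (expHom L n) U _ (expStr L U C) :=
  let := expStr L U C
  { map_onFunction := fun _ _ => rfl, map_onRelation := fun _ _ => rfl }

/-- The new predicate symbol of the expanded language. -/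
def newPred (L : FirstOrder.Language.{u, u}) (n : ℕ) : (expLang L n).Relations n :=
  Sum.inr ⟨⟨rfl⟩⟩

/-- An `L`-isomorphism respecting the new predicate is an isomorphism of the expansions. -/
def expEquiv {L : FirstOrder.Language.{u, u}} {M N : Type u} [L.Structure M] [L.Structure N]
    {n : ℕ} {SM : (expLang L n).Structure M} {SN : (expLang L n).Structure N}
    [(expHom L n).IsExpansionOn M]
    [(expHom L n).IsExpansionOn N] (f : M ≃[L] N)
    (hf : ∀ c : Fin n → M, Structure.RelMap (newPred L n) (f ∘ c) ↔
      Structure.RelMap (newPred L n) c) : M ≃[expLang L n] N where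
  toEquiv := f.toEquiv
  map_fun' := by
    rintro m (g | g) c
    · have h1 := (expHom L n).map_onFunction g c
      have h2 := (expHom L n).map_onFunction g (f ∘ c)
      have h3 := f.map_fun g c
      rw [← h1, ← h2] at h3
      exact h3
    · exact g.elim
  map_rel' := by
    rintro m (r | ⟨⟨⟨rfl⟩⟩⟩) c
    · have h1 := (expHom L n).map_onRelation r c
      have h2 := (expHom L n).map_onRelation r (f ∘ c)
      have h3 := f.map_rel r c
      rw [← h1, ← h2] at h3
      exact h3
    · exact hf c

theorem SameType.of_equiv {L : FirstOrder.Language.{u, u}} {M N : Type u} [L.Structure M]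
    [L.Structure N] (f : M ≃[L] N) {X : Type u} {x : X → M} {y : X → N} (h : ∀ i, f (x i) = y i) :
    SameType L x y := fun φ => by
  rw [← StrongHomClass.realize_formula f φ]
  exact iff_of_eq (congrArg φ.Realize (funext h))

theorem EqvOver.symm {L : FirstOrder.Language.{u, u}} {U : Type u} [L.Structure U] {n : ℕ}
    {A : Set U} {C D : Set (Fin n → U)} (h : EqvOver L U A C D) : EqvOver L U A D C :=
  fun φ => (h φ).symm

theorem EqvOver.trans {L : FirstOrder.Language.{u, u}} {U : Type u} [L.Structure U] {n : ℕ}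
    {A : Set U} {C D E : Set (Fin n → U)} (h : EqvOver L U A C D) (h' : EqvOver L U A D E) :
    EqvOver L U A C E :=
  fun φ => (h φ).trans (h' φ)

theorem comp_mem_imgSet {L : FirstOrder.Language.{u, u}} {U : Type u} [L.Structure U] {n : ℕ}
    (f : U ≃[L] U) (C : Set (Fin n → U)) (c : Fin n → U) : f ∘ c ∈ imgSet L U f C ↔ c ∈ C := by
  have : Function.Injective fun b : Fin n → U => f ∘ b := f.injective.comp_left
  exact this.mem_set_image

theorem oSet_subset_eSet {L : FirstOrder.Language.{u, u}} {U : Type u} [L.Structure U] {n : ℕ}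
    {A : Set U} {C D : Set (Fin n → U)} (h : EqvOver L U A C D) :
    oSet L U A C ⊆ eSet L U A D := by
  rintro _ ⟨f, hf, rfl⟩
  refine EqvOver.trans (EqvOver.symm ?_) h
  rw [eqvOver_iff_sameType]
  let e := @expEquiv _ _ _ _ _ _ (expStr L U C) (expStr L U (imgSet L U f C))
    (isExpansionOn_expStr C) (isExpansionOn_expStr (imgSet L U f C)) f
    fun c => comp_mem_imgSet f C c
  exact @SameType.of_equiv _ _ _ (expStr L U C) (expStr L U (imgSet L U f C)) e _ _ _
    fun a => hf _ a.2

theorem card_expLang_lt {κ : Cardinal.{u}} (hκ : ℵ₀ < κ) {L : FirstOrder.Language.{u, u}}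
    (hL : L.card < κ) (n : ℕ) : (expLang L n).card < κ := by
  have h1 : (predLang.{u} n).card ≤ ℵ₀ := by
    have : Countable (predLang.{u} n).Symbols := by
      have h1 : ∀ l, IsEmpty ((predLang.{u} n).Functions l) := fun l =>
        inferInstanceAs (IsEmpty PEmpty)
      have h2 : ∀ l, Countable ((predLang.{u} n).Relations l) := fun l =>
        inferInstanceAs (Countable (ULift (PLift (l = n))))
      unfold Language.Symbols
      infer_instance
    exact mk_le_aleph0_iff.2 this
  rw [expLang, Language.card_sum, lift_id, lift_id]
  exact add_lt_of_lt hκ.le hL (h1.trans_lt hκ)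

/-- Every subset of a saturated structure of inaccessible cardinality has a saturated companion
of the same type. -/
theorem exists_satSet {L : FirstOrder.Language.{u, u}} {U : Type u} [iS : L.Structure U]
    (hsat : IsSatStr U iS) (hinacc : IsInaccessible #U) (hcard : L.card < #U)
    {n : ℕ} (D : Set (Fin n → U)) {A : Set U} (hA : #A < #U) :
    ∃ C : Set (Fin n → U), SatSet L U C ∧ EqvOver L U A C D := by
  have hU : Nonempty U := mk_ne_zero_iff.1 hinacc.ne_zero
  obtain ⟨N, iN, y, hy, hNsat, hN⟩ := @exists_kSat _ hinacc _
    (card_expLang_lt hinacc.aleph0_lt hcard n) U (expStr L U D) hU A hA Subtype.val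
  let : L.Structure N := (expHom L n).reduct N
  have : (expHom L n).IsExpansionOn N := LHom.isExpansionOn_reduct _ _
  have hyL : SameType L (Subtype.val : A → U) y :=
    @SameType.reduct _ _ (expHom L n) _ _ _ _ (expStr L U D) _ (isExpansionOn_expStr D) _ _ _ _ hy
  obtain ⟨f, hf⟩ := hyL.exists_equiv hinacc.aleph0_lt.le ((isSatStr_iff_kSat iS).1 hsat)
    (hNsat.reduct (expHom L n)) le_rfl hN hA
  let C : Set (Fin n → U) := {c | Structure.RelMap (newPred L n) (f ∘ c)}
  let e := @expEquiv _ _ _ _ _ _ (expStr L U C) iN (isExpansionOn_expStr C) _ f fun c => Iff.rfl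
  refine ⟨C, (isSatStr_iff_kSat _).2 (@KSat.of_equiv _ _ _ _ (expStr L U C) _ e hNsat), ?_⟩
  rw [eqvOver_iff_sameType]
  intro φ
  rw [hy φ]
  exact @SameType.of_equiv _ _ _ (expStr L U C) _ e _ _ _ hf φ

theorem Shatters.oSet_of_eSet {L : FirstOrder.Language.{u, u}} {U : Type u} [iS : L.Structure U]
    (hsat : IsSatStr U iS) (hU : ℵ₀ ≤ #U) {n : ℕ} {C D : Set (Fin n → U)} {A : Set U}
    (hA : #A < #U) (hC : SatSet L U C) (hCD : EqvOver L U A C D) {B : Set (Fin n → U)}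
    (hB : B.Finite) (h : Shatters (eSet L U A D) B) : Shatters (oSet L U A C) B := by
  intro H hH
  obtain ⟨E, hE, rfl⟩ := h H hH
  have hne : Nonempty U := mk_ne_zero_iff.1 (aleph0_pos.trans_le hU).ne'
  have : Finite B := hB
  have hEC := eqvOver_iff_sameType.1 (EqvOver.trans hE hCD.symm)
  let F := ↥B × ULift.{u} (Fin n)
  obtain ⟨d, hd⟩ := @SameType.exists_extend _ _ _ _ (expStr L U E) (expStr L U C)
    ((isSatStr_iff_kSat _).1 hC) _ hA _ _ hEC F inferInstance fun p => p.1.1 p.2.down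
  have hdL := @SameType.reduct _ _ (expHom L n) _ _ _ _ (expStr L U E) (expStr L U C)
    (isExpansionOn_expStr E) (isExpansionOn_expStr C) _ _ _ hd
  have hc : #(A ⊕ F) < #U := by
    rw [mk_sum, lift_id, lift_id]
    exact add_lt_of_lt hU hA ((lt_aleph0_of_finite F).trans_le hU)
  have hk := (isSatStr_iff_kSat iS).1 hsat
  obtain ⟨f, hf⟩ := hdL.symm.exists_equiv hU hk hk le_rfl le_rfl hc
  refine ⟨imgSet L U f C, ⟨f, fun a ha => hf (Sum.inl ⟨a, ha⟩), rfl⟩, ?_⟩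
  ext b
  simp only [Set.mem_inter_iff, and_congr_left_iff]
  intro hb
  have hfb : f ∘ (fun i => d (⟨b, hb⟩, ⟨i⟩)) = b := funext fun i => hf (Sum.inr (⟨b, hb⟩, ⟨i⟩))
  have := hd ((newPred L n).formula fun i =>
    Term.var (Sum.inr (⟨b, hb⟩, ⟨i⟩) : ↥A ⊕ F))
  rw [@Formula.realize_rel, @Formula.realize_rel] at this
  have h1 : b ∈ E ↔ (fun i => d (⟨b, hb⟩, ⟨i⟩)) ∈ C := this
  rw [h1, ← comp_mem_imgSet f C, hfb]

theorem FiniteVC.mono {α : Type*} {u v : Set (Set α)} (h : FiniteVC v) (huv : u ⊆ v) :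
    FiniteVC u := by
  obtain ⟨N, hN⟩ := h
  refine ⟨N, fun B hB hs => hN B hB fun H hH => ?_⟩
  obtain ⟨D, hD, hDH⟩ := hs H hH
  exact ⟨D, huv hD, hDH⟩

/-- `e(D/A)` has finite VC dimension iff `o(C/A)` has finite VC dimension for
some (equivalently every) saturated `C ≡_A D`. -/
theorem stmt4 (L : FirstOrder.Language.{u, u}) (U : Type u) [iS : L.Structure U]
    (hsat : IsSatStr U iS) (hinacc : Cardinal.IsInaccessible #U) (hcard : L.card < #U)
    (n : ℕ) (D : Set (Fin n → U)) (A : Set U) (hA : #A < #U) :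
    (FiniteVC (eSet L U A D) ↔
      ∃ C : Set (Fin n → U), SatSet L U C ∧ EqvOver L U A C D ∧ FiniteVC (oSet L U A C)) ∧
    (FiniteVC (eSet L U A D) ↔
      ∀ C : Set (Fin n → U), SatSet L U C → EqvOver L U A C D → FiniteVC (oSet L U A C)) := by
  have hconv : ∀ C : Set (Fin n → U), SatSet L U C → EqvOver L U A C D →
      FiniteVC (oSet L U A C) → FiniteVC (eSet L U A D) := fun C hC hCD ⟨N, hN⟩ =>
    ⟨N, fun B hB hs =>
      hN B hB (hs.oSet_of_eSet hsat hinacc.aleph0_lt.le hA hC hCD B.finite_toSet)⟩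
  obtain ⟨C, hC, hCD⟩ := exists_satSet hsat hinacc hcard D hA
  exact ⟨⟨fun h => ⟨C, hC, hCD, h.mono (oSet_subset_eSet hCD)⟩,
      fun ⟨C', hC', hCD', h⟩ => hconv C' hC' hCD' h⟩,
    ⟨fun h C' _ hCD' => h.mono (oSet_subset_eSet hCD'), fun h => hconv C hC hCD (h C hC hCD)⟩⟩

end Paper
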